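/- A d-cycle on exactly d+2 vertices is the boundary of a (d+1)-simplex: if d ≥ 1, c ∈ C_d is nonzero with ∂_d c = 0, and the union s of the finsets in the support of c has cardinality exactly d+2, then the support of c is precisely the set of all (d+1)-element subsets of s (equivalently, c = Ω^d_{d+2} for the vertex set s). -/

import Mathlib

open Finset

/-- The mod-2 chain group on finsets of `n` vertices: the free `ZMod 2`-module on the
`n`-element finsets of `V`.  The group of `k`-chains `C_k` is `Chain V (k+1)`, since a
`k`-simplex is a `(k+1)`-element finset of vertices. -/
abbrev Chain (V : Type*) (n : ℕ) : Type _ := {s : Finset V // s.card = n} →₀ ZMod 2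

/-- The mod-2 boundary map sending the basis element of an `(n+1)`-element finset `s` to the
sum of the basis elements of its `n`-element subsets.  In simplex-dimension indexing,
`boundary V k : Chain V (k+1) →ₗ Chain V k` is the map `∂_k : C_k → C_(k-1)`. -/
noncomputable def boundary (V : Type*) [DecidableEq V] (n : ℕ) :
    Chain V (n + 1) →ₗ[ZMod 2] Chain V n :=
  Finsupp.lsum (ZMod 2) fun s =>
    LinearMap.toSpanSingleton (ZMod 2) (Chain V n)
      (∑ t ∈ (s.1.powersetCard n).attach,
        Finsupp.single ⟨t.1, (Finset.mem_powersetCard.mp t.2).2⟩ 1)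

/-- The vertex set of a chain: the union of the finsets in its support. -/
noncomputable def vertexSet {V : Type*} [DecidableEq V] {n : ℕ} (c : Chain V n) : Finset V :=
  c.support.sup Subtype.val

theorem boundary_apply {V : Type*} [DecidableEq V] {n : ℕ} (c : Chain V (n + 1))
    (t : {u : Finset V // u.card = n}) :
    boundary V n c t = ∑ s ∈ c.support, if t.1 ⊆ s.1 then c s else 0 := by
  rw [boundary, Finsupp.lsum_apply, Finsupp.sum, Finsupp.finsetSum_apply]
  refine Finset.sum_congr rfl fun s _ => ?_
  rw [LinearMap.toSpanSingleton_apply, Finsupp.smul_apply, Finsupp.finsetSum_apply]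
  split_ifs with h
  · have ht : t.1 ∈ s.1.powersetCard n := Finset.mem_powersetCard.mpr ⟨h, t.2⟩
    rw [Finset.sum_eq_single ⟨t.1, ht⟩]
    · simp
    · intro u _ hu
      refine Finsupp.single_eq_of_ne fun h' => hu (Subtype.ext ?_)
      exact (congrArg Subtype.val h').symm
    · simp
  · rw [Finset.sum_eq_zero, smul_zero]
    intro u _
    refine Finsupp.single_eq_of_ne fun h' => h ?_
    rw [h']
    exact (Finset.mem_powersetCard.mp u.2).1

theorem subset_vertexSet {V : Type*} [DecidableEq V] {n : ℕ} {c : Chain V n}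
    {s : {u : Finset V // u.card = n}} (hs : s ∈ c.support) : s.1 ⊆ vertexSet c :=
  Finset.le_sup (f := Subtype.val) hs

/-- Two distinct facets of a finset `S` are the only facets of `S` containing their
intersection. -/
theorem eq_or_eq_of_inter_subset {V : Type*} [DecidableEq V] {d : ℕ} {S p q r : Finset V}
    (hS : S.card = d + 2) (hp : p.card = d + 1) (hq : q.card = d + 1) (hr : r.card = d + 1)
    (hpS : p ⊆ S) (hqS : q ⊆ S) (hrS : r ⊆ S) (hpq : p ≠ q) (h : p ∩ q ⊆ r) :
    r = p ∨ r = q := by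
  have facet : ∀ u : Finset V, u ⊆ S → u.card = d + 1 → ∃ a ∈ S, u = S.erase a := by
    intro u hu hcard
    obtain ⟨a, ha⟩ := Finset.card_eq_one.mp
      (show (S \ u).card = 1 by rw [Finset.card_sdiff_of_subset hu]; omega)
    refine ⟨a, (Finset.mem_sdiff.mp (ha ▸ Finset.mem_singleton_self a)).1, ?_⟩
    rw [← Finset.sdiff_singleton_eq_erase, ← ha, Finset.sdiff_sdiff_eq_self hu]
  obtain ⟨a, ha, rfl⟩ := facet p hpS hp
  obtain ⟨b, hb, rfl⟩ := facet q hqS hq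
  obtain ⟨x, hx, rfl⟩ := facet r hrS hr
  by_contra! hne
  have hxa : x ≠ a := fun e => hne.1 (e ▸ rfl)
  have hxb : x ≠ b := fun e => hne.2 (e ▸ rfl)
  have hmem : x ∈ S.erase a ∩ S.erase b := by simp [hxa, hxb, hx]
  simpa using h hmem

theorem card_inter_of_facets {V : Type*} [DecidableEq V] {d : ℕ} {S p q : Finset V}
    (hS : S.card = d + 2) (hp : p.card = d + 1) (hq : q.card = d + 1)
    (hpS : p ⊆ S) (hqS : q ⊆ S) (hpq : p ≠ q) : (p ∩ q).card = d := by
  have hunion : (p ∪ q).card ≤ d + 2 := hS ▸ Finset.card_le_card (Finset.union_subset hpS hqS)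
  have hadd := Finset.card_union_add_card_inter p q
  have hlt : (p ∩ q).card < d + 1 := by
    by_contra! hle
    have hpi := Finset.eq_of_subset_of_card_le Finset.inter_subset_left (hp.trans_le hle)
    have hqi := Finset.eq_of_subset_of_card_le Finset.inter_subset_right (hq.trans_le hle)
    exact hpq (hpi.symm.trans hqi)
  omega

/-- A `d`-cycle on exactly `d + 2` vertices is the boundary of a `(d+1)`-simplex: if `d ≥ 1`,
`c ∈ C_d` is nonzero with `∂_d c = 0`, and the union `s` of the finsets in the support of `c`
has cardinality exactly `d + 2`, then the support of `c` is precisely the set of all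
`(d+1)`-element subsets of `s`, i.e. `c = Ω^d_(d+2)` on the vertex set `s`. -/
theorem cycle_on_min_vertices_eq_omega {V : Type*} [DecidableEq V] (d : ℕ) (hd : 1 ≤ d)
    (c : Chain V (d + 1)) (hc : c ≠ 0) (hcyc : boundary V d c = 0)
    (hcard : (vertexSet c).card = d + 2) :
    ∀ t : {u : Finset V // u.card = d + 1}, t ∈ c.support ↔ (t : Finset V) ⊆ vertexSet c := by
  refine fun t => ⟨subset_vertexSet, fun ht => ?_⟩
  by_contra htc
  obtain ⟨s, hs⟩ := Finsupp.support_nonempty_iff.mpr hc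
  have hsS := subset_vertexSet hs
  have hst : s.1 ≠ t.1 := fun e => htc (Subtype.ext e ▸ hs)
  have hcoeff := boundary_apply c
    ⟨s.1 ∩ t.1, card_inter_of_facets hcard s.2 t.2 hsS ht hst⟩
  rw [hcyc, Finset.sum_eq_single_of_mem s hs, if_pos Finset.inter_subset_left] at hcoeff
  · exact Finsupp.mem_support_iff.mp hs hcoeff.symm
  · intro r hr hrs
    refine if_neg fun h => ?_
    rcases eq_or_eq_of_inter_subset hcard s.2 t.2 r.2 hsS ht (subset_vertexSet hr) hst h
      with e | e
    · exact hrs (Subtype.ext e)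
    · exact htc (Subtype.ext e ▸ hr)
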